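/- Theorem 1 (Safe programs execute normally): let π be a safe program, i.e. a finite sequence of procedures built up by the rules SAFE-EMPTY (the empty program is safe) and SAFE-EXTEND (π, p is safe when π is safe and {pre(p)} body(p) {post(p)} is derivable in the static semantics). Then for every procedure p of π and every state σ with σ ⊨ pre(p), there exists a state σ' such that ⟨σ, body(p)⟩ ⇓ σ' in the operational semantics and σ' ⊨ post(p). -/

import Mathlib

namespace Pest

/-- Program variables. -/
abbrev Var := String

/-- Values. -/
abbrev Val := Int

/-- States map variables to values. -/
abbrev State := Var → Val

/-- State update `σ[v ↦ n]`. -/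
def State.upd (σ : State) (v : Var) (n : Val) : State :=
  fun w => if w = v then n else σ w

/-- Expressions: a partial evaluation `⟦e⟧σ` together with a safety predicate
    `safe(e)` such that `σ ⊨ safe(e)` implies `⟦e⟧σ` is defined. -/
structure Expr (α : Type) where
  eval : State → Option α
  safe : State → Prop
  safe_eval : ∀ σ : State, safe σ → (eval σ).isSome

abbrev IExpr := Expr Val
abbrev BExpr := Expr Bool

/-- Predicates on states; `σ ⊨ p` is `p σ`. -/
abbrev Pred := State → Prop

/-- Semantic entailment `p ⊨ q`: every state satisfying `p` satisfies `q`. -/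
def Entails (p q : Pred) : Prop := ∀ σ : State, p σ → q σ

/-- Pest statements.  A while-loop `while g :?! inv :# var do s od` carries an
    invariant annotation `inv` and an integer variant annotation `var`. -/
inductive Stmt where
  | skip : Stmt
  | assign : Var → IExpr → Stmt
  | seq : Stmt → Stmt → Stmt
  | ite : BExpr → Stmt → Stmt → Stmt
  | whileLoop : BExpr → BExpr → IExpr → Stmt → Stmt   -- guard, invariant, variant, body

/-- Big-step operational semantics `⟨σ, s⟩ ⇓ σ'`.  Annotations act as
    assertions: the invariant must evaluate to true before each evaluation of
    the guard, and when the guard is true the variant must be strictly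
    positive before the body and strictly smaller after it; otherwise the
    computation gets stuck (no derivation exists). -/
inductive BigStep : State → Stmt → State → Prop where
  | skip (σ : State) : BigStep σ .skip σ
  | assign {σ : State} {v : Var} {e : IExpr} {n : Val} :
      e.eval σ = some n → BigStep σ (.assign v e) (σ.upd v n)
  | seq {σ σ' σ'' : State} {s₁ s₂ : Stmt} :
      BigStep σ s₁ σ' → BigStep σ' s₂ σ'' → BigStep σ (.seq s₁ s₂) σ''
  | iteTrue {σ σ' : State} {g : BExpr} {s₁ s₂ : Stmt} :
      g.eval σ = some true → BigStep σ s₁ σ' → BigStep σ (.ite g s₁ s₂) σ'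
  | iteFalse {σ σ' : State} {g : BExpr} {s₁ s₂ : Stmt} :
      g.eval σ = some false → BigStep σ s₂ σ' → BigStep σ (.ite g s₁ s₂) σ'
  | whileFalse {σ : State} {g inv : BExpr} {vr : IExpr} {s : Stmt} :
      inv.eval σ = some true → g.eval σ = some false →
      BigStep σ (.whileLoop g inv vr s) σ
  | whileTrue {σ σ' σ'' : State} {g inv : BExpr} {vr : IExpr} {s : Stmt} {n n' : Val} :
      inv.eval σ = some true → g.eval σ = some true →
      vr.eval σ = some n → 0 < n →
      BigStep σ s σ' →
      vr.eval σ' = some n' → n' < n →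
      BigStep σ' (.whileLoop g inv vr s) σ'' →
      BigStep σ (.whileLoop g inv vr s) σ''

/-- Hoare-style static semantics `{p} s {q}`.  The rules are the semantic
    renderings of S-SKIP, S-ASSIGN, S-SEQ, S-IF and S-WHILE; in S-WHILE the
    ghost variable `var₀` recording the entry value of the variant is rendered
    by indexing the intermediate predicates `p'`, `q'` by that value `n`. -/
inductive Hoare : Pred → Stmt → Pred → Prop where
  | skip {p q : Pred} : Entails p q → Hoare p .skip q
  | assign {p q : Pred} {v : Var} {e : IExpr} :
      Entails p e.safe →
      Entails (fun σ => ∃ n : Val, p (σ.upd v n) ∧ e.eval (σ.upd v n) = some (σ v)) q →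
      Hoare p (.assign v e) q
  | seq {p r q : Pred} {s₁ s₂ : Stmt} :
      Hoare p s₁ r → Hoare r s₂ q → Hoare p (.seq s₁ s₂) q
  | ite {p p₁ q₁ p₂ q₂ q : Pred} {g : BExpr} {s₁ s₂ : Stmt} :
      Entails p g.safe →
      Entails (fun σ => p σ ∧ g.eval σ = some true) p₁ →
      Hoare p₁ s₁ q₁ → Entails q₁ q →
      Entails (fun σ => p σ ∧ g.eval σ = some false) p₂ →
      Hoare p₂ s₂ q₂ → Entails q₂ q →
      Hoare p (.ite g s₁ s₂) q
  | whileLoop {p q : Pred} {g inv : BExpr} {vr : IExpr} {s : Stmt}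
      (p' q' : Val → Pred) :
      (∀ σ : State, inv.safe σ) →
      Entails (fun σ => inv.eval σ = some true) vr.safe →
      Entails (fun σ => inv.eval σ = some true) g.safe →
      Entails p (fun σ => inv.eval σ = some true) →
      (∀ n : Val, Entails
        (fun σ => inv.eval σ = some true ∧ g.eval σ = some true ∧ vr.eval σ = some n)
        (p' n)) →
      (∀ n : Val, Entails (p' n) (fun σ => ∃ m : Val, vr.eval σ = some m ∧ 0 < m)) →
      (∀ n : Val, Hoare (p' n) s (q' n)) →
      (∀ n : Val, Entails (q' n) (fun σ => inv.eval σ = some true)) →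
      (∀ n : Val, Entails (q' n) (fun σ => ∃ m : Val, vr.eval σ = some m ∧ m < n)) →
      Entails (fun σ => inv.eval σ = some true ∧ g.eval σ = some false) q →
      Hoare p (.whileLoop g inv vr s) q

/-- A procedure consists of a precondition, a postcondition and a body. -/
structure Proc where
  pre : Pred
  post : Pred
  body : Stmt

/-- Safe programs: a program is a finite sequence of procedures built up by
    SAFE-EMPTY and SAFE-EXTEND (`π, p` is safe when `π` is safe and
    `{pre(p)} body(p) {post(p)}` is derivable in the static semantics). -/
inductive SafeProgram : List Proc → Prop where
  | empty : SafeProgram []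
  | extend {π : List Proc} {p : Proc} :
      SafeProgram π → Hoare p.pre p.body p.post → SafeProgram (π ++ [p])

theorem State.upd_upd_self (σ : State) (v : Var) (n : Val) :
    (σ.upd v n).upd v (σ v) = σ := by
  funext w
  by_cases h : w = v <;> simp [State.upd, h]

theorem State.upd_same (σ : State) (v : Var) (n : Val) : σ.upd v n v = n := by
  simp [State.upd]

theorem Expr.exists_eval_of_safe {α : Type} (e : Expr α) {σ : State} (h : e.safe σ) :
    ∃ a, e.eval σ = some a :=
  Option.isSome_iff_exists.mp (e.safe_eval σ h)

/-- Total correctness of an annotated loop, given total correctness of its body. -/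
theorem BigStep.exists_whileLoop {g inv : BExpr} {vr : IExpr} {s : Stmt}
    (hvr : ∀ σ, inv.eval σ = some true → ∃ n, vr.eval σ = some n)
    (hg : ∀ σ, inv.eval σ = some true → ∃ b, g.eval σ = some b)
    (hbody : ∀ σ n, inv.eval σ = some true → g.eval σ = some true → vr.eval σ = some n →
      0 < n ∧ ∃ σ', BigStep σ s σ' ∧ inv.eval σ' = some true ∧
        ∃ m, vr.eval σ' = some m ∧ m < n)
    {σ : State} (hσ : inv.eval σ = some true) :
    ∃ σ', BigStep σ (.whileLoop g inv vr s) σ' ∧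
      inv.eval σ' = some true ∧ g.eval σ' = some false := by
  obtain ⟨n, hn⟩ := hvr σ hσ
  induction hk : n.toNat using Nat.strong_induction_on generalizing σ n with
  | _ k ih =>
    obtain ⟨_ | _, hb⟩ := hg σ hσ
    · exact ⟨σ, .whileFalse hσ hb, hσ, hb⟩
    · obtain ⟨hpos, σ₁, hstep, hinv, m, hm, hlt⟩ := hbody σ n hσ hb hn
      obtain ⟨σ₂, hloop, hpost⟩ := ih m.toNat (hk ▸ (Int.toNat_lt_toNat hpos).mpr hlt) hinv m hm rfl
      exact ⟨σ₂, .whileTrue hσ hb hn hpos hstep hm hlt hloop, hpost⟩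

/-- The static semantics is sound for total correctness. -/
theorem Hoare.exists_bigStep {p q : Pred} {s : Stmt} (h : Hoare p s q) :
    ∀ σ, p σ → ∃ σ', BigStep σ s σ' ∧ q σ' := by
  induction h with
  | skip hpq => exact fun σ hσ => ⟨σ, .skip σ, hpq σ hσ⟩
  | @assign p q v e hsafe hpq =>
    intro σ hσ
    obtain ⟨n, hn⟩ := e.exists_eval_of_safe (hsafe σ hσ)
    refine ⟨σ.upd v n, .assign hn, hpq _ ⟨σ v, ?_⟩⟩
    rw [State.upd_upd_self, State.upd_same]
    exact ⟨hσ, hn⟩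
  | seq _ _ ih₁ ih₂ =>
    intro σ hσ
    obtain ⟨σ₁, h₁, hr⟩ := ih₁ σ hσ
    obtain ⟨σ₂, h₂, hq⟩ := ih₂ σ₁ hr
    exact ⟨σ₂, .seq h₁ h₂, hq⟩
  | @ite p p₁ q₁ p₂ q₂ q g s₁ s₂ hsafe hp₁ _ hq₁ hp₂ _ hq₂ ih₁ ih₂ =>
    intro σ hσ
    obtain ⟨_ | _, hb⟩ := g.exists_eval_of_safe (hsafe σ hσ)
    · obtain ⟨σ', hstep, hq⟩ := ih₂ σ (hp₂ σ ⟨hσ, hb⟩)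
      exact ⟨σ', .iteFalse hb hstep, hq₂ σ' hq⟩
    · obtain ⟨σ', hstep, hq⟩ := ih₁ σ (hp₁ σ ⟨hσ, hb⟩)
      exact ⟨σ', .iteTrue hb hstep, hq₁ σ' hq⟩
  | @whileLoop p q g inv vr s p' q' _ hvr hg hp hp' hpos _ hinv hlt hq ih =>
    intro σ hσ
    obtain ⟨σ', hstep, hpost⟩ := BigStep.exists_whileLoop (s := s)
      (fun τ hτ => vr.exists_eval_of_safe (hvr τ hτ))
      (fun τ hτ => g.exists_eval_of_safe (hg τ hτ))
      (fun τ n hτ hgτ hn => by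
        have hτ' := hp' n τ ⟨hτ, hgτ, hn⟩
        obtain ⟨m, hm, hm_pos⟩ := hpos n τ hτ'
        obtain rfl : n = m := Option.some.inj (hn.symm.trans hm)
        obtain ⟨τ', hstep, hτq⟩ := ih n τ hτ'
        exact ⟨hm_pos, τ', hstep, hinv n τ' hτq, hlt n τ' hτq⟩)
      (hp σ hσ)
    exact ⟨σ', hstep, hq σ' hpost⟩

theorem SafeProgram.hoare {π : List Proc} (hπ : SafeProgram π) :
    ∀ p ∈ π, Hoare p.pre p.body p.post := by
  induction hπ with
  | empty => simp
  | extend _ hp ih =>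
    intro r hr
    rcases List.mem_append.mp hr with hr | hr
    · exact ih r hr
    · rw [List.mem_singleton.mp hr]
      exact hp

/-- Theorem 1 (Safe programs execute normally): for every procedure `p` of a
    safe program `π` and every state `σ` satisfying `pre(p)`, there is a state
    `σ'` with `⟨σ, body(p)⟩ ⇓ σ'` and `σ' ⊨ post(p)`. -/
theorem safe_programs_execute_normally {π : List Proc} (hπ : SafeProgram π) :
    ∀ p ∈ π, ∀ σ : State, p.pre σ →
      ∃ σ' : State, BigStep σ p.body σ' ∧ p.post σ' := by
  exact fun p hp => (hπ.hoare p hp).exists_bigStep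

end Pest
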